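/- Let f : ℝ × ℝ → ℝ be C^∞ and let u be a C^∞ solution of u'(t) = f(t, u(t)) on [a,b]. Fix t ∈ [a,b), write f, f_t, f_u, f_tu, f_uu for f and its partial derivatives evaluated at (t, u(t)) and write v = u(t). Take the three-stage IMQ-RBF Runge–Kutta method with a₂₁ = c₂ = 1/2, a₃₁ = −1, a₃₂ = 2, c₃ = 1, b₁ = 1/6, b₂ = 2/3, b₃ = 1/6, and shape parameters ε₂² = (−f²·f_u·f_uu − f·f_t·f_uu + f·f_u³ − f·f_u·f_tu + f_t·f_u² − f_t·f_tu)/(v·f·f_uu − v·f_u² + v·f_tu − f·f_u) and ε₃² = −ε₂², assuming the denominator v·f·f_uu − v·f_u² + v·f_tu − f·f_u is nonzero. Then the local truncation error τ(t,h) satisfies τ(t,h) = O(h⁴) as h → 0⁺; that is, there exist C > 0 and h₀ > 0 such that |τ(t,h)| ≤ C h⁴ for all 0 < h ≤ h₀ (so the method is fourth-order accurate). -/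

import Mathlib

/-- Directional (partial) derivative of `f : ℝ × ℝ → ℝ` in the direction `d`;
`pd f (1,0) = f_t`, `pd f (0,1) = f_u`, and iterates give higher partials. -/
noncomputable def pd (f : ℝ × ℝ → ℝ) (d : ℝ × ℝ) : ℝ × ℝ → ℝ :=
  fun p => fderiv ℝ f p d

open Asymptotics Filter Topology

theorem contDiff_pd {f : ℝ × ℝ → ℝ} (hf : ContDiff ℝ (⊤ : ℕ∞) f) (d : ℝ × ℝ) :
    ContDiff ℝ (⊤ : ℕ∞) (pd f d) :=
  (hf.fderiv_right (m := (⊤ : ℕ∞)) (by simp)).clm_apply contDiff_const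

theorem pd_comm {f : ℝ × ℝ → ℝ} (hf : ContDiff ℝ (⊤ : ℕ∞) f) (d e : ℝ × ℝ) :
    pd (pd f d) e = pd (pd f e) d := by
  have key : ∀ d e p, pd (pd f d) e p = fderiv ℝ (fderiv ℝ f) p e d := by
    intro d e p
    have hd : DifferentiableAt ℝ (fderiv ℝ f) p :=
      (hf.fderiv_right (m := (⊤ : ℕ∞)) (by simp)).differentiable (by simp) p
    change fderiv ℝ (fun q => fderiv ℝ f q d) p e = _
    rw [fderiv_clm_apply hd (by fun_prop)]
    simp
  funext p
  rw [key, key]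
  exact (hf.contDiffAt.isSymmSndFDerivAt
    (by simpa using WithTop.coe_le_coe.2 (le_top : (2 : ℕ∞) ≤ ⊤))) e d

/-- A function vanishing at `0` whose derivative is `O(‖w‖ ^ k)` is `O(‖w‖ ^ (k + 1))`. -/
theorem isBigO_norm_pow_succ_of_hasFDerivWithinAt {E : Type*} [NormedAddCommGroup E]
    [NormedSpace ℝ E] {s : Set E} (hs : Convex ℝ s) (h0 : (0 : E) ∈ s) {R : E → ℝ}
    {R' : E → E →L[ℝ] ℝ} (hR : ∀ w ∈ s, HasFDerivWithinAt R (R' w) s w) (hR0 : R 0 = 0) {k : ℕ}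
    (hO : R' =O[𝓝[s] 0] fun w => ‖w‖ ^ k) : R =O[𝓝[s] 0] fun w => ‖w‖ ^ (k + 1) := by
  obtain ⟨C, hC⟩ := hO.bound
  obtain ⟨ε, hε, hb⟩ := Metric.mem_nhdsWithin_iff.1 hC
  refine IsBigO.of_bound C (Metric.mem_nhdsWithin_iff.2 ⟨ε, hε, ?_⟩)
  rintro w ⟨hw, hws⟩
  have hw' : ‖w‖ < ε := by simpa using hw
  have hC0 : 0 ≤ C * ‖w‖ ^ k := by
    have := hb ⟨hw, hws⟩
    simp only [Set.mem_ofPred_eq, norm_pow, norm_norm] at this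
    exact (norm_nonneg _).trans this
  have hC1 : ∀ z ∈ s ∩ Metric.closedBall 0 ‖w‖, ‖R' z‖ ≤ C * ‖w‖ ^ k := by
    rintro z ⟨hzs, hz⟩
    have hz' : ‖z‖ ≤ ‖w‖ := by simpa using hz
    have h1 := hb ⟨by simpa using hz'.trans_lt hw', hzs⟩
    simp only [Set.mem_ofPred_eq, norm_pow, norm_norm] at h1
    rcases le_or_gt 0 C with hc | hc
    · exact h1.trans (by gcongr)
    · have h2 : C * ‖z‖ ^ k ≤ 0 := mul_nonpos_of_nonpos_of_nonneg hc.le (by positivity)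
      linarith
  have := (hs.inter (convex_closedBall (0 : E) ‖w‖)).norm_image_sub_le_of_norm_hasFDerivWithin_le
    (fun z hz => (hR z hz.1).mono Set.inter_subset_left) hC1 (x := 0) (y := w)
    ⟨h0, by simp⟩ ⟨hws, by simp⟩
  simp only [hR0, sub_zero] at this
  simpa [pow_succ, mul_assoc] using this

theorem isBigO_sub_of_pd {G : ℝ × ℝ → ℝ} (hG : ContDiff ℝ (⊤ : ℕ∞) G) (p : ℝ × ℝ)
    {Q A B : ℝ × ℝ → ℝ}
    (hQ : ∀ w, HasFDerivAt Q
      (A w • ContinuousLinearMap.fst ℝ ℝ ℝ + B w • ContinuousLinearMap.snd ℝ ℝ ℝ) w)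
    (hQ0 : Q 0 = G p) {k : ℕ}
    (hA : (fun w => pd G (1, 0) (p + w) - A w) =O[𝓝 0] fun w => ‖w‖ ^ k)
    (hB : (fun w => pd G (0, 1) (p + w) - B w) =O[𝓝 0] fun w => ‖w‖ ^ k) :
    (fun w => G (p + w) - Q w) =O[𝓝 0] fun w => ‖w‖ ^ (k + 1) := by
  have hd : ∀ w, HasFDerivAt (fun w => G (p + w) - Q w)
      ((pd G (1, 0) (p + w) - A w) • ContinuousLinearMap.fst ℝ ℝ ℝ +
        (pd G (0, 1) (p + w) - B w) • ContinuousLinearMap.snd ℝ ℝ ℝ) w := by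
    intro w
    have h1 : HasFDerivAt (fun w => G (p + w)) (fderiv ℝ G (p + w)) w :=
      (hasFDerivAt_comp_add_left p).2 (hG.differentiable (by simp) (p + w)).hasFDerivAt
    refine (h1.sub (hQ w)).congr_fderiv ?_
    ext <;> simp [pd]
  rw [← nhdsWithin_univ] at *
  refine isBigO_norm_pow_succ_of_hasFDerivWithinAt convex_univ (Set.mem_univ _)
    (fun w _ => (hd w).hasFDerivWithinAt) (by simp [hQ0]) ?_
  refine IsBigO.add ?_ ?_
  · exact (IsBigO.of_bound ‖ContinuousLinearMap.fst ℝ ℝ ℝ‖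
      (Eventually.of_forall fun w => by rw [norm_smul, mul_comm])).trans hA
  · exact (IsBigO.of_bound ‖ContinuousLinearMap.snd ℝ ℝ ℝ‖
      (Eventually.of_forall fun w => by rw [norm_smul, mul_comm])).trans hB

theorem taylor_plane_zero {G : ℝ × ℝ → ℝ} (hG : ContDiff ℝ (⊤ : ℕ∞) G) (p : ℝ × ℝ) :
    (fun w => G (p + w) - G p) =O[𝓝 0] fun w => ‖w‖ ^ 1 := by
  have h := (hG.differentiable (by simp) p).isBigO_sub
  have ht : Tendsto (fun w : ℝ × ℝ => p + w) (𝓝 0) (𝓝 p) := by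
    have : ContinuousAt (fun w : ℝ × ℝ => p + w) 0 := by fun_prop
    simpa [ContinuousAt] using this
  have := h.comp_tendsto ht
  simp only [Function.comp_def, add_sub_cancel_left] at this
  simpa using this.norm_right

theorem taylor_plane_one {G : ℝ × ℝ → ℝ} (hG : ContDiff ℝ (⊤ : ℕ∞) G) (p : ℝ × ℝ) :
    (fun w => G (p + w) - (G p + pd G (1, 0) p * w.1 + pd G (0, 1) p * w.2)) =O[𝓝 0]
      fun w => ‖w‖ ^ 2 := by
  refine isBigO_sub_of_pd hG p (fun w => ?_) (by simp)
    (taylor_plane_zero (contDiff_pd hG (1, 0)) p) (taylor_plane_zero (contDiff_pd hG (0, 1)) p)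
  have hx : HasFDerivAt (fun w : ℝ × ℝ => w.1) (ContinuousLinearMap.fst ℝ ℝ ℝ) w := hasFDerivAt_fst
  have hy : HasFDerivAt (fun w : ℝ × ℝ => w.2) (ContinuousLinearMap.snd ℝ ℝ ℝ) w := hasFDerivAt_snd
  refine (((hx.const_mul (pd G (1, 0) p)).const_add (G p)).add
    (hy.const_mul (pd G (0, 1) p))).congr_fderiv ?_
  ext <;> simp

theorem taylor_plane_two {G : ℝ × ℝ → ℝ} (hG : ContDiff ℝ (⊤ : ℕ∞) G) (p : ℝ × ℝ) :
    (fun w => G (p + w) - (G p + pd G (1, 0) p * w.1 + pd G (0, 1) p * w.2 +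
      (pd (pd G (1, 0)) (1, 0) p / 2 * w.1 ^ 2 + pd (pd G (1, 0)) (0, 1) p * (w.1 * w.2) +
        pd (pd G (0, 1)) (0, 1) p / 2 * w.2 ^ 2))) =O[𝓝 0]
      fun w => ‖w‖ ^ 3 := by
  refine isBigO_sub_of_pd hG p (fun w => ?_) (by simp)
    (taylor_plane_one (contDiff_pd hG (1, 0)) p) (taylor_plane_one (contDiff_pd hG (0, 1)) p)
  have hx : HasFDerivAt (fun w : ℝ × ℝ => w.1) (ContinuousLinearMap.fst ℝ ℝ ℝ) w := hasFDerivAt_fst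
  have hy : HasFDerivAt (fun w : ℝ × ℝ => w.2) (ContinuousLinearMap.snd ℝ ℝ ℝ) w := hasFDerivAt_snd
  rw [pd_comm hG (0, 1) (1, 0)]
  refine ((((hx.const_mul _).const_add _).add (hy.const_mul _)).add
    ((((hx.pow 2).const_mul _).add ((hx.mul hy).const_mul _)).add
      ((hy.pow 2).const_mul _))).congr_fderiv ?_
  ext <;> simp <;> ring

theorem taylor_plane_three {G : ℝ × ℝ → ℝ} (hG : ContDiff ℝ (⊤ : ℕ∞) G) (p : ℝ × ℝ) :
    (fun w => G (p + w) - (G p + pd G (1, 0) p * w.1 + pd G (0, 1) p * w.2 +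
      (pd (pd G (1, 0)) (1, 0) p / 2 * w.1 ^ 2 + pd (pd G (1, 0)) (0, 1) p * (w.1 * w.2) +
        pd (pd G (0, 1)) (0, 1) p / 2 * w.2 ^ 2) +
      (pd (pd (pd G (1, 0)) (1, 0)) (1, 0) p / 6 * w.1 ^ 3 +
        pd (pd (pd G (1, 0)) (1, 0)) (0, 1) p / 2 * (w.1 ^ 2 * w.2) +
        pd (pd (pd G (1, 0)) (0, 1)) (0, 1) p / 2 * (w.1 * w.2 ^ 2) +
        pd (pd (pd G (0, 1)) (0, 1)) (0, 1) p / 6 * w.2 ^ 3))) =O[𝓝 0]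
      fun w => ‖w‖ ^ 4 := by
  refine isBigO_sub_of_pd hG p (fun w => ?_) (by simp)
    (taylor_plane_two (contDiff_pd hG (1, 0)) p) (taylor_plane_two (contDiff_pd hG (0, 1)) p)
  have hx : HasFDerivAt (fun w : ℝ × ℝ => w.1) (ContinuousLinearMap.fst ℝ ℝ ℝ) w := hasFDerivAt_fst
  have hy : HasFDerivAt (fun w : ℝ × ℝ => w.2) (ContinuousLinearMap.snd ℝ ℝ ℝ) w := hasFDerivAt_snd
  rw [pd_comm hG (0, 1) (1, 0), pd_comm (contDiff_pd hG (1, 0)) (0, 1) (1, 0)]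
  refine (((((hx.const_mul _).const_add _).add (hy.const_mul _)).add
    ((((hx.pow 2).const_mul _).add ((hx.mul hy).const_mul _)).add
      ((hy.pow 2).const_mul _))).add
    (((((hx.pow 3).const_mul _).add (((hx.pow 2).mul hy).const_mul _)).add
      ((hx.mul (hy.pow 2)).const_mul _)).add ((hy.pow 3).const_mul _))).congr_fderiv ?_
  ext <;> simp <;> ring

/-- `φ` has the third-order expansion `a + b h + c h² + d h³ + O(h⁴)` along the filter `l`. -/
def HasCubicExpansion (l : Filter ℝ) (φ : ℝ → ℝ) (a b c d : ℝ) : Prop :=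
  (fun h => φ h - (a + b * h + c * h ^ 2 + d * h ^ 3)) =O[l] fun h => h ^ 4

namespace HasCubicExpansion

variable {l : Filter ℝ} {φ ψ : ℝ → ℝ} {a b c d a' b' c' d' : ℝ}

theorem congr_coeff (h : HasCubicExpansion l φ a b c d) (ha : a = a') (hb : b = b') (hc : c = c')
    (hd : d = d') : HasCubicExpansion l φ a' b' c' d' := by
  subst ha hb hc hd; exact h

theorem isBigO_of_continuous (hl : l ≤ 𝓝 0) {g : ℝ → ℝ} (hg : Continuous g) (k : ℕ) :
    (fun h => h ^ k * g h) =O[l] fun h : ℝ => h ^ k := by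
  have h1 : g =O[l] fun _ => (1 : ℝ) := (hg.tendsto 0).isBigO_one ℝ |>.mono hl
  simpa using (isBigO_refl (fun h : ℝ => h ^ k) l).mul h1

theorem poly (a b c d : ℝ) :
    HasCubicExpansion l (fun h => a + b * h + c * h ^ 2 + d * h ^ 3) a b c d := by
  simp only [HasCubicExpansion, sub_self]; exact isBigO_zero _ _

theorem const (a : ℝ) : HasCubicExpansion l (fun _ => a) a 0 0 0 := by
  simpa using poly (l := l) a 0 0 0

theorem add (h₁ : HasCubicExpansion l φ a b c d) (h₂ : HasCubicExpansion l ψ a' b' c' d') :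
    HasCubicExpansion l (fun h => φ h + ψ h) (a + a') (b + b') (c + c') (d + d') :=
  (IsBigO.add h₁ h₂).congr_left fun h => by ring

theorem const_mul (k : ℝ) (h : HasCubicExpansion l φ a b c d) :
    HasCubicExpansion l (fun h => k * φ h) (k * a) (k * b) (k * c) (k * d) :=
  (IsBigO.const_mul_left h k).congr_left fun h => by ring

theorem of_sub_isBigO (h : HasCubicExpansion l φ a b c d)
    (hO : (fun h => ψ h - φ h) =O[l] fun h => h ^ 4) : HasCubicExpansion l ψ a b c d :=
  (IsBigO.add hO h).congr_left fun h => by ring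

theorem isBigO_one (hl : l ≤ 𝓝 0) (h : HasCubicExpansion l φ a b c d) :
    φ =O[l] fun _ => (1 : ℝ) := by
  have h1 : (fun h : ℝ => h ^ 4) =O[l] fun _ => (1 : ℝ) :=
    (((continuous_pow 4).tendsto (0 : ℝ)).isBigO_one ℝ).mono hl
  have hc : Continuous fun h : ℝ => a + b * h + c * h ^ 2 + d * h ^ 3 := by fun_prop
  have h2 := ((hc.tendsto 0).isBigO_one ℝ).mono hl
  exact ((IsBigO.trans h h1).add h2).congr_left fun h => by ring

theorem isBigO_id (hl : l ≤ 𝓝 0) (h : HasCubicExpansion l φ 0 b c d) :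
    φ =O[l] fun h => h := by
  have h1 : (fun h : ℝ => h ^ 4) =O[l] fun h => h :=
    (isBigO_of_continuous hl (continuous_pow 3) 1).congr (fun h => by ring) fun h => by ring
  have hc : Continuous fun h : ℝ => b + c * h + d * h ^ 2 := by fun_prop
  have h2 := isBigO_of_continuous hl hc 1
  simp only [pow_one] at h2
  exact ((IsBigO.trans h h1).add h2).congr_left fun h => by ring

theorem mul (hl : l ≤ 𝓝 0) (h₁ : HasCubicExpansion l φ a b c d)
    (h₂ : HasCubicExpansion l ψ a' b' c' d') :
    HasCubicExpansion l (fun h => φ h * ψ h) (a * a') (a * b' + b * a')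
      (a * c' + b * b' + c * a') (a * d' + b * c' + c * b' + d * a') := by
  have e₁ := IsBigO.mul h₁ (h₂.isBigO_one hl)
  have e₂ := IsBigO.mul ((poly (l := l) a b c d).isBigO_one hl) h₂
  simp only [mul_one, one_mul] at e₁ e₂
  have hc : Continuous fun h : ℝ => b * d' + c * c' + d * b' + (c * d' + d * c') * h +
      d * d' * h ^ 2 := by fun_prop
  exact ((e₁.add e₂).add (isBigO_of_continuous hl hc 4)).congr_left fun h => by ring

/-- Composition of a smooth function of two variables with expanded arguments. -/
theorem comp_plane (hl : l ≤ 𝓝 0) {f : ℝ × ℝ → ℝ} (hf : ContDiff ℝ (⊤ : ℕ∞) f) (p : ℝ × ℝ)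
    (h₁ : HasCubicExpansion l φ 0 b c d) (h₂ : HasCubicExpansion l ψ 0 b' c' d') :
    HasCubicExpansion l (fun h => f (p + (φ h, ψ h))) (f p)
      (pd f (1, 0) p * b + pd f (0, 1) p * b')
      (pd f (1, 0) p * c + pd f (0, 1) p * c' +
        (pd (pd f (1, 0)) (1, 0) p / 2 * b ^ 2 + pd (pd f (1, 0)) (0, 1) p * (b * b') +
          pd (pd f (0, 1)) (0, 1) p / 2 * b' ^ 2))
      (pd f (1, 0) p * d + pd f (0, 1) p * d' +
        (pd (pd f (1, 0)) (1, 0) p * (b * c) + pd (pd f (1, 0)) (0, 1) p * (b * c' + c * b') +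
          pd (pd f (0, 1)) (0, 1) p * (b' * c')) +
        (pd (pd (pd f (1, 0)) (1, 0)) (1, 0) p / 6 * b ^ 3 +
          pd (pd (pd f (1, 0)) (1, 0)) (0, 1) p / 2 * (b ^ 2 * b') +
          pd (pd (pd f (1, 0)) (0, 1)) (0, 1) p / 2 * (b * b' ^ 2) +
          pd (pd (pd f (0, 1)) (0, 1)) (0, 1) p / 6 * b' ^ 3)) := by
  have hw : (fun h => (φ h, ψ h)) =O[l] fun h => h := (h₁.isBigO_id hl).prod_left (h₂.isBigO_id hl)
  have ht : Tendsto (fun h => (φ h, ψ h)) l (𝓝 0) := hw.trans_tendsto hl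
  have hrem := ((taylor_plane_three hf p).comp_tendsto ht).trans
    (k := fun h : ℝ => h ^ 4) (hw.norm_left.pow 4)
  have hxx := h₁.mul hl h₁
  have hxy := h₁.mul hl h₂
  have hyy := h₂.mul hl h₂
  refine of_sub_isBigO (φ := fun h => _) ?_ hrem
  simp only [pow_succ, pow_zero, one_mul]
  refine congr_coeff (((((const _).add (h₁.const_mul _)).add (h₂.const_mul _)).add
    (((hxx.const_mul _).add (hxy.const_mul _)).add (hyy.const_mul _))).add
    (((((hxx.mul hl h₁).const_mul _).add ((hxx.mul hl h₂).const_mul _)).add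
      ((h₁.mul hl hyy).const_mul _)).add ((hyy.mul hl h₂).const_mul _))) ?_ ?_ ?_ ?_ <;> ring

/-- Expansions of `√(1 + e h²)` and of its reciprocal. -/
theorem sqrt_and_one_div_sqrt (hl : l ≤ 𝓝 0) (e : ℝ) :
    HasCubicExpansion l (fun h => √(1 + e * h ^ 2)) 1 0 (e / 2) 0 ∧
    HasCubicExpansion l (fun h => 1 / √(1 + e * h ^ 2)) 1 0 (-(e / 2)) 0 := by
  have hs : ∀ᶠ h : ℝ in l, |e * h ^ 2| ≤ 1 / 2 := by
    have hc : Continuous fun h : ℝ => |e * h ^ 2| := by fun_prop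
    have := (hc.tendsto 0).eventually_le_const (u := 1 / 2) (by simp)
    exact hl this
  have key : ∀ q : ℝ, |q| ≤ 1 / 2 → |√(1 + q) - (1 + q / 2)| ≤ q ^ 2 ∧
      |1 / √(1 + q) - (1 - q / 2)| ≤ 4 * q ^ 2 := by
    intro q hq
    obtain ⟨h1, h2⟩ := abs_le.1 hq
    have hsq := Real.sq_sqrt (show 0 ≤ 1 + q by linarith)
    have hs2 : 1 / 2 ≤ √(1 + q) := Real.le_sqrt_of_sq_le (by linarith)
    set s := √(1 + q)
    have hA : |s - (1 + q / 2)| ≤ q ^ 2 := by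
      rw [abs_le]; constructor <;> nlinarith [sq_nonneg q]
    refine ⟨hA, ?_⟩
    have hs0 : 0 < s := by linarith
    have : 1 / s - (1 - q / 2) = (q ^ 2 / 4 - (s - (1 + q / 2)) * (1 - q / 2)) / s := by
      field_simp; ring
    rw [this, abs_div, abs_of_pos hs0, div_le_iff₀ hs0]
    have h3 : |q ^ 2 / 4 - (s - (1 + q / 2)) * (1 - q / 2)| ≤ q ^ 2 / 4 + q ^ 2 * (5 / 4) := by
      refine (abs_sub _ _).trans ?_
      rw [abs_mul, abs_of_nonneg (by positivity : 0 ≤ q ^ 2 / 4)]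
      gcongr
      rw [abs_le]; constructor <;> linarith
    nlinarith [sq_nonneg q]
  constructor
  · refine IsBigO.of_bound (e ^ 2) (hs.mono fun h hh => ?_)
    have := (key _ hh).1
    rw [Real.norm_eq_abs, Real.norm_eq_abs, abs_of_nonneg (by positivity : 0 ≤ h ^ 4)]
    convert this using 1
    · congr 1; ring
    · ring
  · refine IsBigO.of_bound (4 * e ^ 2) (hs.mono fun h hh => ?_)
    have := (key _ hh).2
    rw [Real.norm_eq_abs, Real.norm_eq_abs, abs_of_nonneg (by positivity : 0 ≤ h ^ 4)]
    convert this using 1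
    · congr 1; ring
    · ring

theorem mono {l' : Filter ℝ} (h : HasCubicExpansion l φ a b c d) (hl : l' ≤ l) :
    HasCubicExpansion l' φ a b c d := IsBigO.mono h hl

theorem unique (h₁ : HasCubicExpansion (𝓝[>] 0) φ a b c d)
    (h₂ : HasCubicExpansion (𝓝[>] 0) φ a' b' c' d') : a = a' ∧ b = b' ∧ c = c' ∧ d = d' := by
  have key : ∀ (k : ℕ) (x : ℝ) (q : ℝ → ℝ), Continuous q →
      (fun h => x + h * q h) =O[𝓝[>] (0 : ℝ)] (fun h => h ^ (k + 1)) →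
      x = 0 ∧ q =O[𝓝[>] (0 : ℝ)] fun h => h ^ k := by
    intro k x q hq hO
    have hx : x = 0 := by
      have hc : Continuous fun h : ℝ => x + h * q h := by fun_prop
      have t₁ : Tendsto (fun h : ℝ => x + h * q h) (𝓝[>] 0) (𝓝 x) := by
        simpa using (hc.tendsto 0).mono_left nhdsWithin_le_nhds
      have t₂ : Tendsto (fun h : ℝ => h ^ (k + 1)) (𝓝[>] 0) (𝓝 0) := by
        simpa using ((continuous_pow (k + 1)).tendsto (0 : ℝ)).mono_left nhdsWithin_le_nhds
      exact tendsto_nhds_unique t₁ (hO.trans_tendsto t₂)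
    refine ⟨hx, ?_⟩
    subst hx
    have := (isBigO_refl (fun h : ℝ => h⁻¹) (𝓝[>] 0)).mul hO
    refine this.congr' ?_ ?_ <;> filter_upwards [self_mem_nhdsWithin] with h hh
    · have : h ≠ 0 := ne_of_gt hh
      field_simp; simp
    · have : h ≠ 0 := ne_of_gt hh
      field_simp; ring
  have h : (fun h => (a' - a) + h * ((b' - b) + h * ((c' - c) + h * ((d' - d) + h * 0))))
      =O[𝓝[>] (0 : ℝ)] fun h => h ^ 4 := (IsBigO.sub h₁ h₂).congr_left fun h => by ring
  obtain ⟨ha, h⟩ := key _ _ _ (by fun_prop) h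
  obtain ⟨hb, h⟩ := key _ _ _ (by fun_prop) h
  obtain ⟨hc, h⟩ := key _ _ _ (by fun_prop) h
  obtain ⟨hd, -⟩ := key _ _ _ (by fun_prop) h
  refine ⟨?_, ?_, ?_, ?_⟩ <;> linarith

/-- The expansion of a derivative can be integrated. -/
theorem slope_of_hasDerivWithinAt {δ : ℝ} (hδ : 0 < δ) {g g' : ℝ → ℝ}
    (hg : ∀ s ∈ Set.Icc 0 δ, HasDerivWithinAt g (g' s) (Set.Icc 0 δ) s)
    (h : HasCubicExpansion (𝓝[Set.Icc 0 δ] 0) g' a b c d) :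
    HasCubicExpansion (𝓝[Set.Icc 0 δ] 0) g (g 0) a (b / 2) (c / 3) ∧
    HasCubicExpansion (𝓝[>] 0) (fun h => (g h - g 0) / h) a (b / 2) (c / 3) (d / 4) := by
  have hd : ∀ s ∈ Set.Icc 0 δ, HasFDerivWithinAt
      (fun s => g s - (g 0 + a * s + b / 2 * s ^ 2 + c / 3 * s ^ 3 + d / 4 * s ^ 4))
      (ContinuousLinearMap.toSpanSingleton ℝ (g' s - (a + b * s + c * s ^ 2 + d * s ^ 3)))
      (Set.Icc 0 δ) s := by
    intro s hs
    have hi := hasDerivWithinAt_id s (Set.Icc 0 δ)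
    have := (hg s hs).sub (((((hi.const_mul a).const_add (g 0)).add ((hi.pow 2).const_mul (b / 2))).add
      ((hi.pow 3).const_mul (c / 3))).add ((hi.pow 4).const_mul (d / 4)))
    refine HasDerivWithinAt.hasFDerivWithinAt (this.congr_deriv ?_)
    simp; ring
  have hO := isBigO_norm_pow_succ_of_hasFDerivWithinAt (convex_Icc 0 δ) ⟨le_rfl, hδ.le⟩ hd
    (by simp) (k := 4) (by
      refine IsBigO.trans (IsBigO.of_bound 1 (Eventually.of_forall fun s => ?_))
        (IsBigO.norm_right h |>.congr_right fun s => norm_pow s 4)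
      simp)
  have hO' : (fun s => g s - (g 0 + a * s + b / 2 * s ^ 2 + c / 3 * s ^ 3 + d / 4 * s ^ 4))
      =O[𝓝[Set.Icc 0 δ] 0] fun s => s ^ 5 :=
    hO.trans (IsBigO.of_bound 1 (Eventually.of_forall fun s => by simp))
  constructor
  · have e₁ := isBigO_of_continuous (l := 𝓝[Set.Icc 0 δ] 0) nhdsWithin_le_nhds continuous_id 4
    have e₂ := isBigO_of_continuous (l := 𝓝[Set.Icc 0 δ] 0) nhdsWithin_le_nhds
      (continuous_const (y := d / 4)) 4
    refine ((hO'.trans (e₁.congr_left fun s => ?_)).add e₂).congr_left fun s => ?_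
    · simp only [id]; ring
    · ring
  · have hle : 𝓝[>] (0 : ℝ) ≤ 𝓝[Set.Icc 0 δ] 0 := by
      rw [← nhdsWithin_Ioo_eq_nhdsGT hδ]
      exact nhdsWithin_mono _ Set.Ioo_subset_Icc_self
    have := (isBigO_refl (fun h : ℝ => h⁻¹) (𝓝[>] 0)).mul (hO'.mono hle)
    refine this.congr' ?_ ?_ <;> filter_upwards [self_mem_nhdsWithin] with h hh
    · have : h ≠ 0 := ne_of_gt hh
      field_simp; ring
    · have : h ≠ 0 := ne_of_gt hh
      field_simp

theorem exists_of_contDiffOn {δ : ℝ} (hδ : 0 < δ) {g : ℝ → ℝ}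
    (hg : ContDiffOn ℝ (⊤ : ℕ∞) g (Set.Icc 0 δ)) :
    ∃ b c d, HasCubicExpansion (𝓝[Set.Icc 0 δ] 0) g (g 0) b c d := by
  obtain ⟨C, hC⟩ := exists_taylor_mean_remainder_bound (n := 3) hδ.le
    (hg.of_le (WithTop.coe_le_coe.2 (le_top : ((3 + 1 : ℕ) : ℕ∞) ≤ ⊤)))
  refine ⟨iteratedDerivWithin 1 g (Set.Icc 0 δ) 0, iteratedDerivWithin 2 g (Set.Icc 0 δ) 0 / 2,
    iteratedDerivWithin 3 g (Set.Icc 0 δ) 0 / 6, IsBigO.of_bound C ?_⟩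
  filter_upwards [self_mem_nhdsWithin] with s hs
  have h4 : ‖s ^ 4‖ = (s - 0) ^ (3 + 1) := by
    rw [sub_zero, Real.norm_eq_abs, abs_of_nonneg (by positivity)]
  rw [h4]
  have h5 := hC s hs
  simp only [taylorWithinEval_succ, taylor_within_zero_eval, smul_eq_mul] at h5
  convert h5 using 3
  · rfl
  · norm_num [Nat.factorial]
    ring

end HasCubicExpansion

/-- Fourth-order accuracy of the three-stage IMQ-RBF Runge–Kutta method (case I):
`a₂₁ = c₂ = 1/2`, `a₃₁ = −1`, `a₃₂ = 2`, `c₃ = 1`, `b₁ = 1/6`, `b₂ = 2/3`, `b₃ = 1/6`,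
shape parameters
`ε₂² = (−f² f_u f_uu − f f_t f_uu + f f_u³ − f f_u f_tu + f_t f_u² − f_t f_tu)
      /(v f f_uu − v f_u² + v f_tu − f f_u)` and `ε₃² = −ε₂²` (denominator nonzero);
then the local truncation error is `O(h⁴)` as `h → 0⁺`. -/
theorem imq_rk3_fourth_order_I
    (a b : ℝ) (hab : a < b) (f : ℝ × ℝ → ℝ) (hf : ContDiff ℝ (⊤ : ℕ∞) f)
    (u : ℝ → ℝ) (hu : ContDiffOn ℝ (⊤ : ℕ∞) u (Set.Icc a b))
    (hode : ∀ s ∈ Set.Icc a b, HasDerivWithinAt u (f (s, u s)) (Set.Icc a b) s)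
    (t : ℝ) (ht : t ∈ Set.Ico a b) :
    let v := u t
    let F := f (t, v)
    let ft := pd f (1, 0) (t, v)
    let fu := pd f (0, 1) (t, v)
    let ftu := pd (pd f (1, 0)) (0, 1) (t, v)
    let fuu := pd (pd f (0, 1)) (0, 1) (t, v)
    let den := v * F * fuu - v * fu ^ 2 + v * ftu - F * fu
    let eps2 := (-F ^ 2 * fu * fuu - F * ft * fuu + F * fu ^ 3 - F * fu * ftu +
      ft * fu ^ 2 - ft * ftu) / den
    let eps3 := -eps2
    den ≠ 0 →
    ∃ C > 0, ∃ h₀ > 0, ∀ h : ℝ, 0 < h → h ≤ h₀ →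
      let k1 := F
      let k2 := f (t + (1 / 2) * h,
        Real.sqrt (1 + eps2 * (1 / 2) ^ 2 * h ^ 2) * (h * (1 / 2) * k1) +
          v / Real.sqrt (1 + eps2 * (1 / 2) ^ 2 * h ^ 2))
      let k3 := f (t + 1 * h,
        Real.sqrt (1 + eps3 * 1 ^ 2 * h ^ 2) * (h * ((-1) * k1 + 2 * k2)) +
          v / Real.sqrt (1 + eps3 * 1 ^ 2 * h ^ 2))
      |(u (t + h) - u t) / h - ((1 / 6) * k1 + (2 / 3) * k2 + (1 / 6) * k3)| ≤
        C * h ^ 4 := by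
  intro v F ft fu ftu fuu den eps2 eps3 hden
  obtain ⟨hat, htb⟩ := ht
  have hδ : 0 < b - t := by linarith
  have hmaps : Set.MapsTo (fun s => t + s) (Set.Icc 0 (b - t)) (Set.Icc a b) := fun s hs =>
    ⟨by linarith [hs.1], by linarith [hs.2]⟩
  have hg : ∀ s ∈ Set.Icc 0 (b - t), HasDerivWithinAt (fun s => u (t + s))
      (f (t + s, u (t + s))) (Set.Icc 0 (b - t)) s := fun s hs => by
    have := (hode (t + s) (hmaps hs)).comp s ((hasDerivWithinAt_id s _).const_add t) hmaps
    rwa [mul_one] at this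
  have hgc : ContDiffOn ℝ (⊤ : ℕ∞) (fun s => u (t + s)) (Set.Icc 0 (b - t)) :=
    hu.comp (by fun_prop) hmaps
  have hle : 𝓝[>] (0 : ℝ) ≤ 𝓝[Set.Icc 0 (b - t)] 0 := by
    rw [← nhdsWithin_Ioo_eq_nhdsGT hδ]
    exact nhdsWithin_mono _ Set.Ioo_subset_Icc_self
  have hl : 𝓝[>] (0 : ℝ) ≤ 𝓝 0 := nhdsWithin_le_nhds
  have hid : ∀ (l : Filter ℝ) (k : ℝ), HasCubicExpansion l (fun h => k * h) 0 k 0 0 :=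
    fun l k => by simpa using HasCubicExpansion.poly (l := l) 0 k 0 0
  obtain ⟨y₁, y₂, y₃, hy⟩ := HasCubicExpansion.exists_of_contDiffOn hδ hgc
  have hy0 := (hy.add (HasCubicExpansion.const (-v))).congr_coeff
    (show u (t + 0) + -v = 0 by simp [v]) (add_zero _) (add_zero _) (add_zero _)
  have hg' := HasCubicExpansion.comp_plane nhdsWithin_le_nhds hf (t, v) (hid _ 1) hy0
  simp only [Prod.mk_add_mk, one_mul, add_comm (u _) (-v),
    add_neg_cancel_left] at hg'
  obtain ⟨hy', hslope⟩ := HasCubicExpansion.slope_of_hasDerivWithinAt hδ hg hg'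
  obtain ⟨-, h₁, h₂, h₃⟩ := (hy.mono hle).unique (hy'.mono hle)
  have hk₂ := HasCubicExpansion.comp_plane hl hf (t, v) (hid _ (1 / 2))
    (((((HasCubicExpansion.sqrt_and_one_div_sqrt hl (eps2 * (1 / 2) ^ 2)).1.mul hl
      (hid _ (1 / 2 * F))).add ((HasCubicExpansion.sqrt_and_one_div_sqrt hl
        (eps2 * (1 / 2) ^ 2)).2.const_mul v)).add (HasCubicExpansion.const (-v))).congr_coeff
      (show _ = 0 by ring) rfl rfl rfl)
  have hk₃ := HasCubicExpansion.comp_plane hl hf (t, v) (hid _ 1)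
    (((((HasCubicExpansion.sqrt_and_one_div_sqrt hl (eps3 * 1 ^ 2)).1.mul hl
      ((hid _ 1).mul hl ((HasCubicExpansion.const (-1 * F)).add (hk₂.const_mul 2)))).add
        ((HasCubicExpansion.sqrt_and_one_div_sqrt hl
        (eps3 * 1 ^ 2)).2.const_mul v)).add (HasCubicExpansion.const (-v))).congr_coeff
      (show _ = 0 by ring) rfl rfl rfl)
  have hE : eps2 * den = -F ^ 2 * fu * fuu - F * ft * fuu + F * fu ^ 3 - F * fu * ftu +
      ft * fu ^ 2 - ft * ftu := div_mul_cancel₀ _ hden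
  have hτ := (hslope.add ((((HasCubicExpansion.const (1 / 6 * F)).add (hk₂.const_mul (2 / 3))).add
    (hk₃.const_mul (1 / 6))).const_mul (-1))).congr_coeff
    (a' := 0) (b' := 0) (c' := 0) (d' := 0) ?_ ?_ ?_ ?_
  · obtain ⟨C, hC, hb⟩ := IsBigO.exists_pos hτ
    obtain ⟨ε, hε, hsub⟩ := (mem_nhdsGT_iff_exists_Ioc_subset).1 hb.bound
    refine ⟨C, hC, ε, hε, fun h hh hhε => ?_⟩
    have := hsub ⟨hh, hhε⟩
    simp only [Set.mem_ofPred_eq, Real.norm_eq_abs, abs_of_nonneg (by positivity : 0 ≤ h ^ 4)]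
      at this
    intro k1 k2 k3
    have e₂ : f ((t, v) + (1 / 2 * h, √(1 + eps2 * (1 / 2) ^ 2 * h ^ 2) * (1 / 2 * F * h) +
        v * (1 / √(1 + eps2 * (1 / 2) ^ 2 * h ^ 2)) + -v)) = k2 := by
      rw [Prod.mk_add_mk]; congr 2; ring
    have e₃ : f ((t, v) + (1 * h, √(1 + eps3 * 1 ^ 2 * h ^ 2) * (1 * h * (-1 * F + 2 * k2)) +
        v * (1 / √(1 + eps3 * 1 ^ 2 * h ^ 2)) + -v)) = k3 := by
      rw [Prod.mk_add_mk]; congr 2; ring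
    rw [e₂, e₃] at this
    convert this using 2
    rw [add_zero]
    ring
  all_goals
    have hF : f (t, v) = F := rfl
    have hft : pd f (1, 0) (t, v) = ft := rfl
    have hfu : pd f (0, 1) (t, v) = fu := rfl
    have hftu : pd (pd f (1, 0)) (0, 1) (t, v) = ftu := rfl
    have hfuu : pd (pd f (0, 1)) (0, 1) (t, v) = fuu := rfl
    have h_eps : eps3 = -eps2 := rfl
    simp only [hF, hft, hfu, hftu, hfuu, h_eps] at h₁ h₂ h₃ ⊢
  · ring
  · rw [h₁]; ring
  · rw [h₂, h₁]; ring
  · have h_den : den = v * F * fuu - v * fu ^ 2 + v * ftu - F * fu := rfl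
    rw [h_den] at hE
    rw [h₃, h₂, h₁]
    linear_combination (-1 / 24) * hE
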